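/- arXiv:2101.00503 — 2 statements merged into one kernel-verified Lean document; each statement's English description precedes it below -/
import Mathlib

section
/- For λ ∈ [0,1] and 0 ≤ a ≤ b ≤ 1, the modularity slice of the λ-graphon satisfies L(a,b) = ∫ₐᵇ∫ₐᵇ B(x,y) dx dy = (a−b)²·(a+b−1)²·(1−λ)·λ/(3λ+1), where B is the modularity surface of the λ-graphon. -/
open MeasureTheory

/-- The integral of an affine function over an interval. -/
theorem integral_affine (p q a b : ℝ) :
    ∫ x in a..b, (p * x + q) = p * ((b ^ 2 - a ^ 2) / 2) + q * (b - a) := by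
  rw [intervalIntegral.integral_add ((continuous_const_mul p).intervalIntegrable a b)
    intervalIntegrable_const, intervalIntegral.integral_const_mul, integral_id,
    intervalIntegral.integral_const, smul_eq_mul, mul_comm q]

/-- The modularity slice of the λ-graphon satisfies
`L(a,b) = ∫ₐᵇ∫ₐᵇ B(x,y) dx dy = (a−b)²(a+b−1)²(1−λ)λ/(3λ+1)`. -/
theorem lambda_graphon_modularity_slice
    (lam : ℝ) (hlam : lam ∈ Set.Icc (0:ℝ) 1)
    (W : ℝ → ℝ → ℝ) (hW : ∀ x y, W x y = (1 - lam) * x * y + lam)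
    (k : ℝ → ℝ) (hk : ∀ x, k x = ∫ y in (0:ℝ)..1, W x y)
    (μ : ℝ) (hμ : μ = ∫ x in (0:ℝ)..1, ∫ y in (0:ℝ)..1, W x y)
    (B : ℝ → ℝ → ℝ) (hB : ∀ x y, B x y = W x y - k x * k y / μ)
    (a b : ℝ) (ha : 0 ≤ a) (hab : a ≤ b) (hb : b ≤ 1) :
    (∫ x in a..b, ∫ y in a..b, B x y) =
      (a - b) ^ 2 * (a + b - 1) ^ 2 * (1 - lam) * lam / (3 * lam + 1) := by
  have hk' : ∀ x, k x = (1 - lam) / 2 * x + lam := fun x => by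
    simp only [hk, hW, integral_affine]
    ring
  have hμ' : μ = (3 * lam + 1) / 4 := by
    simp only [hμ, ← hk, hk', integral_affine]
    ring
  have hne : μ ≠ 0 := by
    have := hlam.1
    rw [hμ']
    positivity
  have hB' : ∀ x y, B x y = (1 - lam) * lam / μ * (1 * x + -1 / 2) * (1 * y + -1 / 2) :=
    fun x y => by
      rw [hB, hW, hk', hk']
      field_simp
      rw [hμ']
      ring
  simp only [hB', intervalIntegral.integral_const_mul, intervalIntegral.integral_mul_const,
    integral_affine]
  rw [show 3 * lam + 1 = 4 * μ by rw [hμ']; ring]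
  ring
end

section
/- For λ ∈ (0,1), the two-community sliced modularity of the λ-graphon with boundary x₁ ∈ [0,1] satisfies L(0,x₁) + L(x₁,1) = κ·x₁²·(x₁−1)², where κ = 2(1−λ)λ/(1+3λ) > 0, L(a,b) = ∫ₐᵇ∫ₐᵇ B(x,y) dx dy, and B is the modularity surface of the λ-graphon. -/
open MeasureTheory

theorem integral_mul_id_add_const (p q a b : ℝ) :
    ∫ y in a..b, (p * y + q) = p * ((b ^ 2 - a ^ 2) / 2) + q * (b - a) := by
  rw [intervalIntegral.integral_add (Continuous.intervalIntegrable (by fun_prop) _ _)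
    (Continuous.intervalIntegrable (by fun_prop) _ _)]
  rw [intervalIntegral.integral_const_mul p fun y : ℝ => y, integral_id,
    intervalIntegral.integral_const, smul_eq_mul]
  ring

/-- For `λ ∈ (0,1)`, the two-community sliced modularity of the λ-graphon with
boundary `x₁ ∈ [0,1]` equals `κ·x₁²·(x₁−1)²` with `κ = 2(1−λ)λ/(1+3λ) > 0`. -/
theorem lambda_graphon_two_community_sliced_modularity
    (lam : ℝ) (hlam : lam ∈ Set.Ioo (0:ℝ) 1)
    (W : ℝ → ℝ → ℝ) (hW : ∀ x y, W x y = (1 - lam) * x * y + lam)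
    (k : ℝ → ℝ) (hk : ∀ x, k x = ∫ y in (0:ℝ)..1, W x y)
    (μ : ℝ) (hμ : μ = ∫ x in (0:ℝ)..1, ∫ y in (0:ℝ)..1, W x y)
    (B : ℝ → ℝ → ℝ) (hB : ∀ x y, B x y = W x y - k x * k y / μ)
    (L : ℝ → ℝ → ℝ) (hL : ∀ a b, L a b = ∫ x in a..b, ∫ y in a..b, B x y)
    (κ : ℝ) (hκ : κ = 2 * (1 - lam) * lam / (1 + 3 * lam))
    (x₁ : ℝ) (hx₁ : x₁ ∈ Set.Icc (0:ℝ) 1) :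
    L 0 x₁ + L x₁ 1 = κ * x₁ ^ 2 * (x₁ - 1) ^ 2 ∧ 0 < κ := by
  obtain ⟨h0, h1⟩ := hlam
  have hpos : 0 < 1 + 3 * lam := by linarith
  have hk' : ∀ x, k x = (1 - lam) / 2 * x + lam := fun x => by
    simp only [hk, hW, integral_mul_id_add_const]
    ring
  have hμ' : μ = (1 + 3 * lam) / 4 := by
    simp only [hμ, ← hk, hk', integral_mul_id_add_const]
    ring
  -- The modularity surface is the rank-one kernel `2κ (x - 1/2) (y - 1/2)`.
  have hB' : ∀ x y, B x y = 2 * κ * (x - 1 / 2) * y + -(κ * (x - 1 / 2)) := fun x y => by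
    rw [hB, hW, hk', hk', hμ', hκ]
    field_simp
    ring
  have hL' : ∀ a b, L a b = 2 * κ * ((b ^ 2 - a ^ 2) / 2 - (b - a) / 2) ^ 2 := fun a b => by
    have hinner : ∀ x, ∫ y in a..b, B x y =
        2 * κ * ((b ^ 2 - a ^ 2) / 2 - (b - a) / 2) * x +
          -(κ * ((b ^ 2 - a ^ 2) / 2 - (b - a) / 2)) := fun x => by
      simp only [hB', integral_mul_id_add_const]
      ring
    simp only [hL, hinner, integral_mul_id_add_const]
    ring
  refine ⟨?_, ?_⟩
  · rw [hL', hL']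
    ring
  · rw [hκ]
    have : 0 < 1 - lam := by linarith
    positivity
end
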